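/- arXiv:2601.17643 — 4 statements merged into one kernel-verified Lean document; each statement's English description precedes it below -/
import Mathlib

section
/- Let N ≥ 1 and let f : ℝ^N → ℝ be twice continuously differentiable with f(X) ≥ 0 for all X and with all second-order partial derivatives of f bounded. Then there exists a constant C > 0 such that 1 + f(X) ≤ C (1 + f(Y)) (1 + ‖X − Y‖²) for all X, Y ∈ ℝ^N. In particular, m := 1 + f is an order function on ℝ^N. -/
/-- First-order Taylor estimate for a function with second derivative bounded by `M`. -/
theorem abs_sub_sub_fderiv_le_of_norm_iteratedFDeriv_two_le
    {E : Type*} [NormedAddCommGroup E] [NormedSpace ℝ E] {f : E → ℝ} {M : ℝ}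
    (hf : ContDiff ℝ 2 f) (hM : ∀ x, ‖iteratedFDeriv ℝ 2 f x‖ ≤ M) (y h : E) :
    |f (y + h) - f y - fderiv ℝ f y h| ≤ M * ‖h‖ ^ 2 := by
  have hM0 : 0 ≤ M := (norm_nonneg _).trans (hM y)
  have hf' : ContDiff ℝ 1 (fderiv ℝ f) := hf.fderiv_right (by norm_num)
  have hbound : ∀ x, ‖fderiv ℝ (fderiv ℝ f) x‖ ≤ M := fun x => by
    have key := hM x
    rwa [← norm_iteratedFDeriv_fderiv (n := 1), ← norm_iteratedFDeriv_fderiv (n := 0),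
      norm_iteratedFDeriv_zero] at key
  have hlip : ∀ x, ‖fderiv ℝ f x - fderiv ℝ f y‖ ≤ M * ‖x - y‖ := fun x =>
    convex_univ.norm_image_sub_le_of_norm_fderiv_le
      (fun z _ => (hf'.differentiable (by norm_num)) z) (fun z _ => hbound z)
      (Set.mem_univ y) (Set.mem_univ x)
  have key := (convex_closedBall y ‖h‖).norm_image_sub_le_of_norm_fderiv_le' (𝕜 := ℝ) (f := f)
    (φ := fderiv ℝ f y) (C := M * ‖h‖) (x := y) (y := y + h)
    (fun z _ => (hf.differentiable (by norm_num)) z)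
    (fun z hz => (hlip z).trans
      (mul_le_mul_of_nonneg_left (mem_closedBall_iff_norm.1 hz) hM0))
    (Metric.mem_closedBall_self (norm_nonneg h)) (by simp)
  rw [add_sub_cancel_left, Real.norm_eq_abs] at key
  linarith

/-- A nonnegative function with second derivative bounded by `M` grows at most quadratically
around any point, with constants controlled by its value there. -/
theorem le_two_mul_add_of_norm_iteratedFDeriv_two_le
    {E : Type*} [NormedAddCommGroup E] [NormedSpace ℝ E] {f : E → ℝ} {M : ℝ}
    (hf : ContDiff ℝ 2 f) (hf0 : ∀ x, 0 ≤ f x) (hM : ∀ x, ‖iteratedFDeriv ℝ 2 f x‖ ≤ M)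
    (x y : E) : f x ≤ 2 * f y + 2 * M * ‖x - y‖ ^ 2 := by
  have hpos := abs_le.1 (abs_sub_sub_fderiv_le_of_norm_iteratedFDeriv_two_le hf hM y (x - y))
  have hneg := abs_le.1 (abs_sub_sub_fderiv_le_of_norm_iteratedFDeriv_two_le hf hM y (-(x - y)))
  rw [add_sub_cancel] at hpos
  rw [map_neg, norm_neg] at hneg
  linarith [hpos.2, hneg.2, hf0 (y + -(x - y))]

/-- If `f : ℝ^N → ℝ` is C², nonnegative, with bounded second derivatives,
then `1 + f` is an order function:
`1 + f X ≤ C (1 + f Y)(1 + ‖X − Y‖²)` for all `X, Y`. -/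
theorem stmt1 (N : ℕ) (hN : 1 ≤ N) (f : EuclideanSpace ℝ (Fin N) → ℝ)
    (hf : ContDiff ℝ 2 f) (hf0 : ∀ X, 0 ≤ f X)
    (M : ℝ) (hHess : ∀ X, ‖iteratedFDeriv ℝ 2 f X‖ ≤ M) :
    ∃ C > 0, ∀ X Y : EuclideanSpace ℝ (Fin N),
      1 + f X ≤ C * (1 + f Y) * (1 + ‖X - Y‖ ^ 2) := by
  have hM0 : 0 ≤ M := (norm_nonneg _).trans (hHess 0)
  refine ⟨2 + 2 * M, by positivity, fun X Y => ?_⟩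
  have hle := le_two_mul_add_of_norm_iteratedFDeriv_two_le hf hf0 hHess X Y
  have hY := hf0 Y
  have hr : 0 ≤ ‖X - Y‖ ^ 2 := by positivity
  generalize ‖X - Y‖ ^ 2 = r at *
  have h₁ : 0 ≤ f Y * r := mul_nonneg hY hr
  have h₂ : 0 ≤ M * f Y := mul_nonneg hM0 hY
  have h₃ : 0 ≤ M * (f Y * r) := mul_nonneg hM0 h₁
  linarith
end

section
/- Let N ≥ 1 and let f, g : ℝ^N → ℝ be twice continuously differentiable functions, each with all second-order partial derivatives bounded, such that f(X) ≥ 0 for all X and such that there is C > 0 with |g(X)| ≤ C (1 + f(X)) for all X ∈ ℝ^N. Then there exists C' > 0 such that ‖∇g(X)‖ ≤ C' (1 + f(X)) for all X ∈ ℝ^N. -/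
/-- A crude second-order Taylor estimate from a bound on the second derivative. -/
theorem norm_sub_sub_fderiv_le_of_norm_iteratedFDeriv_two_le
    {E F : Type*} [NormedAddCommGroup E] [NormedSpace ℝ E]
    [NormedAddCommGroup F] [NormedSpace ℝ F] {h : E → F} (hh : ContDiff ℝ 2 h) {M : ℝ}
    (hM : ∀ x, ‖iteratedFDeriv ℝ 2 h x‖ ≤ M) (x v : E) :
    ‖h (x + v) - h x - fderiv ℝ h x v‖ ≤ M * ‖v‖ ^ 2 := by
  have hM0 : 0 ≤ M := (norm_nonneg _).trans (hM x)
  have hd : Differentiable ℝ h := hh.differentiable (by norm_num)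
  have hd' : Differentiable ℝ (fderiv ℝ h) :=
    (hh.fderiv_right (m := 1) (by norm_num)).differentiable (by norm_num)
  have hlip : ∀ y, ‖fderiv ℝ h y - fderiv ℝ h x‖ ≤ M * ‖y - x‖ := fun y =>
    convex_univ.norm_image_sub_le_of_norm_fderiv_le (fun z _ => hd' z)
      (fun z _ => by
        have := hM z
        rwa [← norm_iteratedFDeriv_fderiv, norm_iteratedFDeriv_one] at this)
      (Set.mem_univ x) (Set.mem_univ y)
  have := (convex_closedBall x ‖v‖).norm_image_sub_le_of_norm_fderiv_le'
    (f := h) (φ := fderiv ℝ h x) (C := M * ‖v‖) (x := x) (y := x + v)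
    (fun z _ => hd z)
    (fun z hz => (hlip z).trans
      (mul_le_mul_of_nonneg_left (by simpa [dist_eq_norm] using hz) hM0))
    (by simp) (by simp)
  simpa [pow_two, mul_assoc] using this

/-- If `f, g : ℝ^N → ℝ` are C² with bounded second derivatives, `f ≥ 0`,
and `|g| ≤ C (1 + f)`, then `‖∇g‖ ≤ C' (1 + f)` for some `C' > 0`. -/
theorem stmt2 (N : ℕ) (hN : 1 ≤ N) (f g : EuclideanSpace ℝ (Fin N) → ℝ)
    (hf : ContDiff ℝ 2 f) (hg : ContDiff ℝ 2 g)
    (Mf Mg : ℝ) (hHf : ∀ X, ‖iteratedFDeriv ℝ 2 f X‖ ≤ Mf)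
    (hHg : ∀ X, ‖iteratedFDeriv ℝ 2 g X‖ ≤ Mg)
    (hf0 : ∀ X, 0 ≤ f X) (C : ℝ) (hC : 0 < C)
    (hgf : ∀ X, |g X| ≤ C * (1 + f X)) :
    ∃ C' > 0, ∀ X, ‖gradient g X‖ ≤ C' * (1 + f X) := by
  have hMf : 0 ≤ Mf := (norm_nonneg _).trans (hHf 0)
  have hMg : 0 ≤ Mg := (norm_nonneg _).trans (hHg 0)
  refine ⟨C * (3 + 2 * Mf) + Mg, by positivity, fun X => ?_⟩
  have hX := hf0 X
  have key : ∀ v : EuclideanSpace ℝ (Fin N), ‖v‖ = 1 →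
      ‖fderiv ℝ g X v‖ ≤ (C * (3 + 2 * Mf) + Mg) * (1 + f X) := by
    intro v hv
    have h1 := norm_sub_sub_fderiv_le_of_norm_iteratedFDeriv_two_le hf hHf X v
    have h2 := norm_sub_sub_fderiv_le_of_norm_iteratedFDeriv_two_le hf hHf X (-v)
    have h3 := norm_sub_sub_fderiv_le_of_norm_iteratedFDeriv_two_le hg hHg X v
    simp only [norm_neg, map_neg, hv, one_pow, mul_one, Real.norm_eq_abs, abs_le] at h1 h2 h3
    have h4 := hf0 (X + -v)
    have hfv : f (X + v) ≤ 2 * f X + 2 * Mf := by linarith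
    have hgv := (hgf (X + v)).trans (mul_le_mul_of_nonneg_left (add_le_add_right hfv 1) hC.le)
    have hgX := hgf X
    have h5 : 0 ≤ C * Mf * f X := by positivity
    have h6 : 0 ≤ Mg * f X := by positivity
    rw [abs_le] at hgv hgX
    rw [Real.norm_eq_abs, abs_le]
    constructor <;> nlinarith
  rw [gradient, LinearIsometryEquiv.norm_map]
  exact ContinuousLinearMap.opNorm_le_of_unit_norm (by positivity) key
end

section
/- Let N ≥ 1 and let φ : ℝ × ℝ^N → ℝ^N be continuous with φ(0, X) = X and φ(s + t, X) = φ(s, φ(t, X)) for all s, t ∈ ℝ and X ∈ ℝ^N. Let a : ℝ^N → ℝ be continuous, let T > 0, and define J : ℝ → ℝ by J(t) = −(t + 1)/2 for −1 ≤ t < 0, J(t) = (1 − t)/2 for 0 ≤ t ≤ 1, and J(t) = 0 for |t| > 1. Define G(X) := ∫_{−T}^{T} J(t/T) a(φ(t, X)) dt. Then for every X ∈ ℝ^N, the function s ↦ G(φ(s, X)) is differentiable at s = 0 with derivative equal to (1/(2T)) ∫_{−T}^{T} a(φ(t, X)) dt − a(X). -/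
/-- The piecewise linear function `J` with `J(t) = −(t+1)/2` on `[−1, 0)`,
`J(t) = (1−t)/2` on `[0, 1]`, and `J(t) = 0` for `|t| > 1`; its distributional
derivative is `δ(t) − ½·1_{[−1,1]}(t)`. -/
noncomputable def Jfun (t : ℝ) : ℝ :=
  if t < -1 then 0 else if t < 0 then -(t + 1) / 2 else if t ≤ 1 then (1 - t) / 2 else 0

theorem hasDerivAt_integral_zero {f : ℝ → ℝ} (hf : Continuous f) (x : ℝ) :
    HasDerivAt (fun x => ∫ u in (0 : ℝ)..x, f u) (f x) x :=
  intervalIntegral.integral_hasDerivAt_right (hf.intervalIntegrable _ _)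
    (hf.stronglyMeasurableAtFilter _ _) hf.continuousAt

theorem integral_affine_mul_comp_add_right {f F H : ℝ → ℝ} (hf : Continuous f)
    (hF : ∀ x, HasDerivAt F (f x) x) (hH : ∀ x, HasDerivAt H (F x) x) (c k p q s : ℝ) :
    ∫ t in p..q, (c + k * t) * f (t + s) =
      ((c + k * q) * F (q + s) - k * H (q + s)) - ((c + k * p) * F (p + s) - k * H (p + s)) := by
  refine intervalIntegral.integral_eq_sub_of_hasDerivAt
    (f := fun t => (c + k * t) * F (t + s) - k * H (t + s)) (fun t _ => ?_)
    (Continuous.intervalIntegrable (by fun_prop) _ _)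
  have h := ((((hasDerivAt_id t).const_mul k).const_add c).mul ((hF (t + s)).comp_add_const t s)).sub
    (((hH (t + s)).comp_add_const t s).const_mul k)
  exact h.congr_deriv (by simp only [id]; ring)

theorem integral_Jfun_mul_comp_add_right {f F H : ℝ → ℝ} (hf : Continuous f)
    (hF : ∀ x, HasDerivAt F (f x) x) (hH : ∀ x, HasDerivAt H (F x) x) {T : ℝ} (hT : 0 < T)
    (s : ℝ) :
    ∫ t in (-T)..T, Jfun (t / T) * f (t + s) =
      1 / (2 * T) * (H (T + s) - H (-T + s)) - F s := by
  have hneg : Set.EqOn (fun t => (-(1 / 2) + -(1 / (2 * T)) * t) * f (t + s))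
      (fun t => Jfun (t / T) * f (t + s)) (Set.uIoo (-T) 0) := by
    intro t ht
    rw [Set.uIoo_of_le (by linarith)] at ht
    have h1 : ¬ t / T < -1 := by rw [div_lt_iff₀ hT]; linarith [ht.1]
    have h2 : t / T < 0 := div_neg_of_neg_of_pos ht.2 hT
    simp only [Jfun, if_neg h1, if_pos h2]
    field_simp
    ring
  have hpos : Set.EqOn (fun t => (1 / 2 + -(1 / (2 * T)) * t) * f (t + s))
      (fun t => Jfun (t / T) * f (t + s)) (Set.uIoo 0 T) := by
    intro t ht
    rw [Set.uIoo_of_le hT.le] at ht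
    have h0 : 0 ≤ t / T := div_nonneg ht.1.le hT.le
    have h1 : t / T ≤ 1 := by rw [div_le_iff₀ hT]; linarith [ht.2]
    simp only [Jfun, if_neg (by linarith : ¬ t / T < -1), if_neg (not_lt.2 h0), if_pos h1]
    field_simp
    ring
  have hint (c k p q : ℝ) : IntervalIntegrable (fun t => (c + k * t) * f (t + s))
      MeasureTheory.volume p q := Continuous.intervalIntegrable (by fun_prop) _ _
  rw [← intervalIntegral.integral_add_adjacent_intervals
      ((hint _ _ _ _).congr_uIoo hneg) ((hint _ _ _ _).congr_uIoo hpos),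
    ← intervalIntegral.integral_congr_uIoo hneg, ← intervalIntegral.integral_congr_uIoo hpos,
    integral_affine_mul_comp_add_right hf hF hH, integral_affine_mul_comp_add_right hf hF hH]
  simp only [zero_add]
  field_simp
  ring

/-- For a continuous flow `φ` and continuous `a`, the weight
`G(X) = ∫_{−T}^{T} J(t/T) a(φ(t, X)) dt` satisfies: the derivative of `s ↦ G(φ(s, X))`
at `s = 0` equals the time average `(1/(2T)) ∫_{−T}^{T} a(φ(t, X)) dt − a(X)`. -/
theorem stmt9 (N : ℕ) (hN : 1 ≤ N)
    (φ : ℝ → EuclideanSpace ℝ (Fin N) → EuclideanSpace ℝ (Fin N))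
    (hφcont : Continuous fun p : ℝ × EuclideanSpace ℝ (Fin N) => φ p.1 p.2)
    (hφ0 : ∀ X, φ 0 X = X)
    (hφadd : ∀ s t X, φ (s + t) X = φ s (φ t X))
    (a : EuclideanSpace ℝ (Fin N) → ℝ) (ha : Continuous a) (T : ℝ) (hT : 0 < T) :
    ∀ X : EuclideanSpace ℝ (Fin N),
      HasDerivAt (fun s => ∫ t in (-T)..T, Jfun (t / T) * a (φ t (φ s X)))
        ((1 / (2 * T)) * (∫ t in (-T)..T, a (φ t X)) - a X) 0 := by
  intro X
  set f : ℝ → ℝ := fun t => a (φ t X) with hfdef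
  have hf : Continuous f := ha.comp (hφcont.comp (by fun_prop : Continuous fun t : ℝ => (t, X)))
  set F : ℝ → ℝ := fun x => ∫ u in (0 : ℝ)..x, f u
  have hF : ∀ x, HasDerivAt F (f x) x := hasDerivAt_integral_zero hf
  have hFc : Continuous F := continuous_iff_continuousAt.2 fun x => (hF x).continuousAt
  have hH := hasDerivAt_integral_zero hFc
  have hG : (fun s => ∫ t in (-T)..T, Jfun (t / T) * a (φ t (φ s X))) = fun s =>
      1 / (2 * T) * ((∫ u in (0 : ℝ)..(T + s), F u) - ∫ u in (0 : ℝ)..(-T + s), F u) - F s := by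
    funext s
    simp only [← hφadd]
    exact integral_Jfun_mul_comp_add_right hf hF hH hT s
  have hval : (∫ t in (-T)..T, f t) = F (T + 0) - F (-T + 0) := by
    simp only [add_zero]
    exact intervalIntegral.integral_eq_sub_of_hasDerivAt (fun x _ => hF x)
      (hf.intervalIntegrable _ _)
  have ha0 : a X = f 0 := by simp only [hfdef, hφ0]
  rw [hG, hval, ha0]
  exact ((((hH (T + 0)).comp_const_add T 0).sub
    ((hH (-T + 0)).comp_const_add (-T) 0)).const_mul _).sub (hF 0)
end

section
/- Let N ≥ 1, let b : ℂ^N × ℂ^N → ℂ be a symmetric ℂ-bilinear form, and let K : ℝ^N → ℝ^N be a linear map (with ℝ^N regarded as the real points of ℂ^N). Assume Re b(X, X) ≥ 0 for all X ∈ ℝ^N, and assume there is c > 0 such that Re b(X, X) − 2 Im b(X, KX) ≥ c‖X‖² for all X ∈ ℝ^N. Then there exists δ₀ > 0 such that for all δ ∈ (0, δ₀] and all X ∈ ℝ^N: Re b(X + iδKX, X + iδKX) ≥ (cδ/2)‖X‖². -/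
/-- The canonical inclusion `ℝ^N → ℂ^N` (real points of complex Euclidean space). -/
noncomputable def iotaC (N : ℕ) (v : EuclideanSpace ℝ (Fin N)) : EuclideanSpace ℂ (Fin N) :=
  (WithLp.equiv 2 (Fin N → ℂ)).symm fun k => ((v k : ℝ) : ℂ)

theorem norm_iotaC (N : ℕ) (v : EuclideanSpace ℝ (Fin N)) : ‖iotaC N v‖ = ‖v‖ := by
  simp [EuclideanSpace.norm_eq, iotaC]

theorem exists_norm_bilin_le {E : Type*} [NormedAddCommGroup E] [NormedSpace ℂ E]
    [FiniteDimensional ℂ E] (b : E →ₗ[ℂ] E →ₗ[ℂ] ℂ) :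
    ∃ C, 0 ≤ C ∧ ∀ z w, ‖b z w‖ ≤ C * ‖z‖ * ‖w‖ := by
  let B : E →L[ℂ] E →L[ℂ] ℂ := LinearMap.toContinuousLinearMap
    ((LinearMap.toContinuousLinearMap (𝕜 := ℂ) (E := E) (F' := ℂ)).toLinearMap ∘ₗ b)
  exact ⟨‖B‖, norm_nonneg B, fun z w => B.le_opNorm₂ z w⟩

theorem re_bilin_add_I_smul {E : Type*} [AddCommGroup E] [Module ℂ E]
    (b : E →ₗ[ℂ] E →ₗ[ℂ] ℂ) (hsymm : ∀ z w, b z w = b w z) (δ : ℝ) (z w : E) :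
    (b (z + (δ * Complex.I) • w) (z + (δ * Complex.I) • w)).re =
      (b z z).re - 2 * δ * (b z w).im - δ ^ 2 * (b w w).re := by
  simp [hsymm w z]
  ring

/-- If `b` is a symmetric ℂ-bilinear form on `ℂ^N` with `Re b(X, X) ≥ 0` on
real points and `Re b(X, X) − 2 Im b(X, KX) ≥ c‖X‖²`, then on the deformation
`X ↦ X + iδKX` one has `Re b ≥ (cδ/2)‖X‖²` for all sufficiently small `δ > 0`. -/
theorem stmt16 (N : ℕ) (hN : 1 ≤ N)
    (b : EuclideanSpace ℂ (Fin N) →ₗ[ℂ] EuclideanSpace ℂ (Fin N) →ₗ[ℂ] ℂ)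
    (hsymm : ∀ z w, b z w = b w z)
    (K : EuclideanSpace ℝ (Fin N) →ₗ[ℝ] EuclideanSpace ℝ (Fin N))
    (hpos : ∀ X : EuclideanSpace ℝ (Fin N), 0 ≤ (b (iotaC N X) (iotaC N X)).re)
    (c : ℝ) (hc : 0 < c)
    (hell : ∀ X : EuclideanSpace ℝ (Fin N),
      c * ‖X‖ ^ 2 ≤ (b (iotaC N X) (iotaC N X)).re -
        2 * (b (iotaC N X) (iotaC N (K X))).im) :
    ∃ δ₀ > 0, ∀ δ : ℝ, 0 < δ → δ ≤ δ₀ → ∀ X : EuclideanSpace ℝ (Fin N),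
      (c * δ / 2) * ‖X‖ ^ 2 ≤
        (b (iotaC N X + (δ * Complex.I) • iotaC N (K X))
          (iotaC N X + (δ * Complex.I) • iotaC N (K X))).re := by
  obtain ⟨C, hC, hb⟩ := exists_norm_bilin_le b
  let L := LinearMap.toContinuousLinearMap K
  set M := C * ‖L‖ ^ 2 with hM
  have hM0 : 0 ≤ M := by positivity
  have hbound : ∀ X, (b (iotaC N (K X)) (iotaC N (K X))).re ≤ M * ‖X‖ ^ 2 := fun X => by
    have hK : ‖K X‖ ≤ ‖L‖ * ‖X‖ := L.le_opNorm X
    calc (b (iotaC N (K X)) (iotaC N (K X))).re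
        ≤ ‖b (iotaC N (K X)) (iotaC N (K X))‖ := Complex.re_le_norm _
      _ ≤ C * ‖K X‖ * ‖K X‖ := by simpa only [norm_iotaC] using hb (iotaC N (K X)) (iotaC N (K X))
      _ ≤ C * (‖L‖ * ‖X‖) * (‖L‖ * ‖X‖) := by gcongr
      _ = M * ‖X‖ ^ 2 := by rw [hM]; ring
  refine ⟨min 1 (c / (2 * (M + 1))), by positivity, fun δ hδ hle X => ?_⟩
  have hδ1 : δ ≤ 1 := hle.trans (min_le_left _ _)
  have hδM : δ * (2 * (M + 1)) ≤ c :=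
    (le_div_iff₀ (by positivity)).mp (hle.trans (min_le_right _ _))
  rw [re_bilin_add_I_smul b hsymm]
  have h1 := mul_nonneg (sub_nonneg.mpr hδ1) (hpos X)
  have h2 := mul_le_mul_of_nonneg_left (hell X) hδ.le
  have h3 := mul_le_mul_of_nonneg_left (hbound X) (sq_nonneg δ)
  have h4 : 0 ≤ δ * (c / 2 - δ * M) * ‖X‖ ^ 2 := by
    have : 0 ≤ c / 2 - δ * M := by linarith
    positivity
  linarith
end
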